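/- Let λ ∈ F \ F_q, let t = [F_q(λ) : F_q], let k be an integer with 1 ≤ k < t and 2k ≤ t, and let S = ⟨1, λ, …, λ^{k−1}⟩_{F_q}. Then ω_{2i}(Orb(S)) = (q+1)·q^{2i−1} for every i ∈ {1,…,k−1}, and ω_{2k}(Orb(S)) = (q^n − q^{2k−1})/(q − 1). -/

import Mathlib

open Module

section Defs

variable {F : Type*} [Field F]

/-- The subspace `α·S = {α * s : s ∈ S}` of `F`, for `S` a subspace over the subfield `Fq`. -/
noncomputable def smulSub (Fq : Subfield F) (α : F) (S : Submodule Fq F) : Submodule Fq F :=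
  S.map (LinearMap.mulLeft Fq α)

/-- The one-orbit cyclic subspace code `Orb(S) = {αS : α ∈ Fˣ}`. -/
def Orb (Fq : Subfield F) (S : Submodule Fq F) : Set (Submodule Fq F) :=
  {T | ∃ α : F, α ≠ 0 ∧ T = smulSub Fq α S}

/-- The number of subspaces `αS` (for `α ∈ Fˣ`) with `dim_{Fq}(S ∩ αS) = d`.
For `dim_{Fq} S = k` and `d = k - i` this is the weight-distribution entry `ω_{2i}(Orb S)`. -/
noncomputable def wt (Fq : Subfield F) (S : Submodule Fq F) (d : ℕ) : ℕ :=
  Set.ncard {T | T ∈ Orb Fq S ∧ finrank Fq ↥(S ⊓ T) = d}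

/-- The stabilizer `H(V) = {x ∈ Fˣ : xV = V} ∪ {0}` of a set `V ⊆ F`. -/
def HStabSet (V : Set F) : Set F :=
  {x : F | x ≠ 0 ∧ (fun y => x * y) '' V = V} ∪ {0}

/-- An `Fqt`-subspace of `F` viewed as an `Fq`-subspace, for `Fq ≤ Fqt`. -/
def toFqSub (Fq Fqt : Subfield F) (h : Fq ≤ Fqt) (W : Submodule Fqt F) : Submodule Fq F where
  carrier := W
  add_mem' := fun ha hb => W.add_mem ha hb
  zero_mem' := W.zero_mem
  smul_mem' := fun c _ hx => W.smul_mem (⟨c.1, h c.2⟩ : Fqt) hx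

/-- The subfield `Fqt` viewed as an `Fq`-subspace of `F`, for `Fq ≤ Fqt`. -/
def subfieldModule (Fq Fqt : Subfield F) (h : Fq ≤ Fqt) : Submodule Fq F where
  carrier := Fqt
  add_mem' := fun ha hb => Fqt.add_mem ha hb
  zero_mem' := Fqt.zero_mem
  smul_mem' := fun c _ hx => Fqt.mul_mem (h c.2) hx

/-- `Orb(S)` is an `r`-FWS code, where `k = dim_{Fq} S`: the weight-distribution entries
`ω_{2i}` are positive for `i ∈ {1, …, k - r}` and zero for `i ∈ {k - r + 1, …, k}`. -/
def IsRFWS (Fq : Subfield F) (S : Submodule Fq F) (k r : ℕ) : Prop :=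
  (∀ i, 1 ≤ i → i ≤ k - r → 0 < wt Fq S (k - i)) ∧
  (∀ i, k - r + 1 ≤ i → i ≤ k → wt Fq S (k - i) = 0)

end Defs

open Polynomial

section PowSpan

variable {F : Type*} [Field F]

theorem mem_smulSub {K : Subfield F} {α : F} {S : Submodule K F} {x : F} :
    x ∈ smulSub K α S ↔ ∃ y ∈ S, α * y = x := by
  simp [smulSub, Submodule.mem_map]

/-- The span of `1, lam, …, lam ^ (m - 1)`, as the values at `lam` of the polynomials of degree
less than `m`. -/
noncomputable def powSpan (K : Subfield F) (lam : F) (m : ℕ) : Submodule K F :=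
  (degreeLT K m).map (aeval lam).toLinearMap

theorem mem_powSpan {K : Subfield F} {lam : F} {m : ℕ} {x : F} :
    x ∈ powSpan K lam m ↔ ∃ p : K[X], p.degree < m ∧ aeval lam p = x := by
  simp [powSpan, Submodule.mem_map, mem_degreeLT]

theorem powSpan_eq_span (K : Subfield F) (lam : F) (m : ℕ) :
    powSpan K lam m = Submodule.span K {x : F | ∃ j < m, x = lam ^ j} := by
  classical
  rw [powSpan, degreeLT_eq_span_X_pow, Submodule.map_span]
  congr 1
  ext x
  simp [eq_comm]

theorem powSpan_mono (K : Subfield F) (lam : F) {m k : ℕ} (h : m ≤ k) :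
    powSpan K lam m ≤ powSpan K lam k :=
  Submodule.map_mono (degreeLT_mono h)

theorem eq_zero_of_aeval_eq_zero {K : Subfield F} {lam : F} {p : K[X]}
    (hp : p.degree < (minpoly K lam).natDegree) (h : aeval lam p = 0) : p = 0 := by
  by_contra hp0
  have h1 := minpoly.degree_le_of_ne_zero K lam hp0 h
  have h2 := natDegree_le_natDegree h1
  rw [degree_eq_natDegree hp0] at hp
  exact absurd (Nat.cast_lt.1 hp) (not_lt.2 h2)

theorem finrank_degreeLT (K : Type*) [Field K] (m : ℕ) : finrank K (degreeLT K m) = m := by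
  rw [(degreeLTEquiv K m).finrank_eq, finrank_fin_fun]

theorem finrank_map_mul_aeval {K : Subfield F} {lam : F} {f : K[X]} (hf : f ≠ 0) {r : ℕ}
    (hr : ∀ h : K[X], h.degree < r → (h * f).degree < (minpoly K lam).natDegree) :
    finrank K ((degreeLT K r).map
      ((aeval lam).toLinearMap ∘ₗ LinearMap.mulRight K f)) = r := by
  rw [← LinearMap.range_domRestrict, LinearMap.finrank_range_of_inj, finrank_degreeLT]
  rw [injective_iff_map_eq_zero]
  rintro ⟨h, hh⟩ h0
  rw [mem_degreeLT] at hh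
  have := eq_zero_of_aeval_eq_zero (hr h hh) (by simpa using h0)
  simpa [hf] using this

/-- If `α = f(lam) / g(lam)` in lowest terms, of height at most `k`, then the dimension of
`S ∩ αS` is determined by the height of the fraction. -/
theorem finrank_powSpan_inf_smulSub {K : Subfield F} {lam α : F} {f g : K[X]} {k m : ℕ}
    (hk : 2 * k ≤ (minpoly K lam).natDegree) (hm : m ≤ k) (hα : α ≠ 0)
    (hfg : IsCoprime f g) (hf : f.natDegree ≤ k) (hg : g.natDegree ≤ k)
    (hg0 : aeval lam g ≠ 0) (h : α * aeval lam g = aeval lam f) :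
    finrank K ↥(powSpan K lam m ⊓ smulSub K α (powSpan K lam m)) =
      m - max f.natDegree g.natDegree := by
  have hgne : g ≠ 0 := by rintro rfl; simp at hg0
  have hfne : f ≠ 0 := by rintro rfl; simp [hα] at h; exact hg0 (by simp [h])
  have key : powSpan K lam m ⊓ smulSub K α (powSpan K lam m) =
      (degreeLT K (m - max f.natDegree g.natDegree)).map
        ((aeval lam).toLinearMap ∘ₗ LinearMap.mulRight K f) := by
    ext x
    simp only [Submodule.mem_inf, mem_smulSub, mem_powSpan, Submodule.mem_map, mem_degreeLT,
      LinearMap.comp_apply, LinearMap.mulRight_apply, AlgHom.toLinearMap_apply]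
    constructor
    · rintro ⟨⟨b, hb, rfl⟩, _, ⟨a, ha, rfl⟩, hab⟩
      by_cases ha0 : a = 0
      · subst ha0
        exact ⟨0, by simp, by simpa using hab⟩
      have hb' : b.natDegree < m := by
        by_cases hb0 : b = 0
        · subst hb0
          rw [degree_eq_natDegree ha0] at ha
          have : a.natDegree < m := by exact_mod_cast ha
          simp; omega
        · rw [degree_eq_natDegree hb0] at hb
          exact_mod_cast hb
      have ha' : a.natDegree < m := by
        rw [degree_eq_natDegree ha0] at ha
        exact_mod_cast ha
      have hz : f * a - g * b = 0 := by
        apply eq_zero_of_aeval_eq_zero (lam := lam)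
        · have h1 : (f * a).natDegree ≤ f.natDegree + a.natDegree := natDegree_mul_le
          have h2 : (g * b).natDegree ≤ g.natDegree + b.natDegree := natDegree_mul_le
          have h3 := natDegree_sub_le (f * a) (g * b)
          refine degree_le_natDegree.trans_lt ?_
          have : (f * a - g * b).natDegree < (minpoly K lam).natDegree := by omega
          exact_mod_cast this
        · simp only [map_sub, map_mul, ← h, ← hab]
          ring
      have hz' : f * a = g * b := sub_eq_zero.1 hz
      obtain ⟨c, rfl⟩ : g ∣ a := hfg.symm.dvd_of_dvd_mul_left ⟨b, hz'⟩
      have hbc : b = f * c := by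
        apply mul_left_cancel₀ hgne
        rw [← hz']; ring
      subst hbc
      have hc0 : c ≠ 0 := right_ne_zero_of_mul ha0
      rw [natDegree_mul hgne hc0] at ha'
      rw [natDegree_mul hfne hc0] at hb'
      refine ⟨c, ?_, by rw [mul_comm]⟩
      rw [degree_eq_natDegree hc0]
      have : c.natDegree < m - max f.natDegree g.natDegree := by omega
      exact_mod_cast this
    · rintro ⟨c, hc, rfl⟩
      by_cases hc0 : c = 0
      · subst hc0
        exact ⟨⟨0, by simp, by simp⟩, 0, ⟨0, by simp, by simp⟩, by simp⟩
      rw [degree_eq_natDegree hc0] at hc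
      have hc' : c.natDegree < m - max f.natDegree g.natDegree := by exact_mod_cast hc
      have deg_lt : ∀ p : K[X], p ≠ 0 → p.natDegree ≤ max f.natDegree g.natDegree →
          (c * p).degree < m := by
        intro p hp hle
        rw [degree_eq_natDegree (mul_ne_zero hc0 hp), natDegree_mul hc0 hp]
        have : c.natDegree + p.natDegree < m := by omega
        exact_mod_cast this
      refine ⟨⟨c * f, deg_lt f hfne (le_max_left _ _), rfl⟩, _,
        ⟨c * g, deg_lt g hgne (le_max_right _ _), rfl⟩, ?_⟩
      simp only [map_mul, ← h]
      ring
  rw [key]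
  apply finrank_map_mul_aeval hfne
  intro c hc
  by_cases hc0 : c = 0
  · subst hc0
    simp only [zero_mul, degree_zero]
    exact WithBot.bot_lt_coe _
  rw [degree_eq_natDegree hc0] at hc
  have hc' : c.natDegree < m - max f.natDegree g.natDegree := by exact_mod_cast hc
  rw [degree_eq_natDegree (mul_ne_zero hc0 hfne), natDegree_mul hc0 hfne]
  have : c.natDegree + f.natDegree < (minpoly K lam).natDegree := by omega
  exact_mod_cast this

theorem exists_isCoprime_aeval {K : Subfield F} {lam α : F} {k : ℕ}
    (hD : powSpan K lam k ⊓ smulSub K α (powSpan K lam k) ≠ ⊥) :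
    ∃ f g : K[X], IsCoprime f g ∧ f.natDegree < k ∧ g.natDegree < k ∧
      aeval lam g ≠ 0 ∧ α * aeval lam g = aeval lam f := by
  classical
  obtain ⟨x, hx, hx0⟩ := Submodule.exists_mem_ne_zero_of_ne_bot hD
  simp only [Submodule.mem_inf, mem_smulSub, mem_powSpan] at hx
  obtain ⟨⟨b, hb, rfl⟩, _, ⟨a, ha, rfl⟩, hab⟩ := hx
  have hb0 : b ≠ 0 := by rintro rfl; simp at hx0
  have haev : aeval lam a ≠ 0 := fun h0 => hx0 (by rw [← hab, h0, mul_zero])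
  have ha0 : a ≠ 0 := by rintro rfl; simp at haev
  rw [degree_eq_natDegree hb0] at hb
  rw [degree_eq_natDegree ha0] at ha
  have hb' : b.natDegree < k := by exact_mod_cast hb
  have ha' : a.natDegree < k := by exact_mod_cast ha
  have hda := GCDMonoid.gcd_dvd_right b a
  have hdb := GCDMonoid.gcd_dvd_left b a
  have hcop := isCoprime_div_gcd_div_gcd (p := b) (q := a) ha0
  have ea := EuclideanDomain.mul_div_cancel' (gcd_ne_zero_of_right ha0) hda
  have eb := EuclideanDomain.mul_div_cancel' (gcd_ne_zero_of_right ha0) hdb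
  set d := GCDMonoid.gcd b a
  set a' := a / d
  set b' := b / d
  rw [← ea, map_mul] at haev
  refine ⟨b', a', hcop, ?_, ?_, right_ne_zero_of_mul haev, ?_⟩
  · exact (natDegree_le_of_dvd (Dvd.intro_left d eb) hb0).trans_lt hb'
  · exact (natDegree_le_of_dvd (Dvd.intro_left d ea) ha0).trans_lt ha'
  · apply mul_left_cancel₀ (left_ne_zero_of_mul haev)
    rw [← eb, ← ea, map_mul, map_mul] at hab
    linear_combination hab

/-- Every nonzero `α` has a height `e ≤ k` that determines the dimensions of all the
intersections `S ∩ αS` with `S = ⟨1, …, lam ^ (m - 1)⟩` and `m ≤ k`. -/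
theorem exists_height {K : Subfield F} {lam : F} {k : ℕ}
    (hk : 2 * k ≤ (minpoly K lam).natDegree) {α : F} (hα : α ≠ 0) :
    ∃ e ≤ k, ∀ m ≤ k,
      finrank K ↥(powSpan K lam m ⊓ smulSub K α (powSpan K lam m)) = m - e := by
  by_cases hD : powSpan K lam k ⊓ smulSub K α (powSpan K lam k) = ⊥
  · refine ⟨k, le_rfl, fun m hm => ?_⟩
    have : powSpan K lam m ⊓ smulSub K α (powSpan K lam m) = ⊥ := by
      rw [eq_bot_iff, ← hD]
      exact inf_le_inf (powSpan_mono K lam hm) (Submodule.map_mono (powSpan_mono K lam hm))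
    rw [this, finrank_bot]
    omega
  · obtain ⟨f, g, hfg, hf, hg, hg0, h⟩ := exists_isCoprime_aeval hD
    exact ⟨max f.natDegree g.natDegree, by omega, fun m hm =>
      finrank_powSpan_inf_smulSub hk hm hα hfg hf.le hg.le hg0 h⟩

theorem smulSub_smulSub (K : Subfield F) (α β : F) (S : Submodule K F) :
    smulSub K α (smulSub K β S) = smulSub K (α * β) S := by
  rw [smulSub, smulSub, smulSub, LinearMap.mulLeft_mul, Submodule.map_comp]

theorem smulSub_one (K : Subfield F) (S : Submodule K F) : smulSub K 1 S = S := by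
  ext x; simp [mem_smulSub]

theorem smulSub_of_mem {K : Subfield F} {c : F} (hc : c ∈ K) (hc0 : c ≠ 0)
    (S : Submodule K F) : smulSub K c S = S := by
  ext x
  rw [mem_smulSub]
  constructor
  · rintro ⟨y, hy, rfl⟩
    exact S.smul_mem (⟨c, hc⟩ : K) hy
  · intro hx
    exact ⟨c⁻¹ * x, S.smul_mem (⟨c⁻¹, K.inv_mem hc⟩ : K) hx, by field_simp⟩

theorem finrank_powSpan {K : Subfield F} {lam : F} {k : ℕ}
    (hk : k ≤ (minpoly K lam).natDegree) : finrank K (powSpan K lam k) = k := by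
  have := finrank_map_mul_aeval (lam := lam) (one_ne_zero (α := K[X])) (r := k) (fun h hh => by
    rw [mul_one]
    exact hh.trans_le (by exact_mod_cast hk))
  rwa [LinearMap.mulRight_one, LinearMap.comp_id] at this

theorem mem_of_smulSub_powSpan_eq {K : Subfield F} {lam : F} {k : ℕ} (hk1 : 1 ≤ k)
    (hk : 2 * k ≤ (minpoly K lam).natDegree) {γ : F} (hγ : γ ≠ 0)
    (h : smulSub K γ (powSpan K lam k) = powSpan K lam k) : γ ∈ K := by
  obtain ⟨e, he, hD⟩ := exists_height hk hγ
  have h1 := hD k le_rfl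
  rw [h, inf_idem, finrank_powSpan (by omega)] at h1
  have h2 := hD 1 hk1
  have hne : powSpan K lam 1 ⊓ smulSub K γ (powSpan K lam 1) ≠ ⊥ := by
    intro h0
    rw [h0, finrank_bot] at h2
    omega
  obtain ⟨f, g, -, hf, hg, hg0, hfg⟩ := exists_isCoprime_aeval hne
  rw [eq_C_of_natDegree_eq_zero (p := f) (by omega),
    eq_C_of_natDegree_eq_zero (p := g) (by omega), aeval_C, aeval_C] at hfg
  rw [eq_C_of_natDegree_eq_zero (p := g) (by omega), aeval_C] at hg0
  rw [eq_div_of_mul_eq hg0 hfg]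
  exact K.div_mem (f.coeff 0).2 (g.coeff 0).2

theorem smulSub_powSpan_eq_iff {K : Subfield F} {lam : F} {k : ℕ} (hk1 : 1 ≤ k)
    (hk : 2 * k ≤ (minpoly K lam).natDegree) {α β : F} (hα : α ≠ 0) (hβ : β ≠ 0) :
    smulSub K α (powSpan K lam k) = smulSub K β (powSpan K lam k) ↔ α / β ∈ K := by
  constructor
  · intro h
    apply mem_of_smulSub_powSpan_eq hk1 hk (div_ne_zero hα hβ)
    rw [div_eq_inv_mul, ← smulSub_smulSub, h, smulSub_smulSub, inv_mul_cancel₀ hβ, smulSub_one]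
  · intro h
    have := smulSub_smulSub K β (α / β) (powSpan K lam k)
    rw [smulSub_of_mem h (div_ne_zero hα hβ), mul_div_cancel₀ _ hβ] at this
    exact this.symm

theorem wt_powSpan_of_infinite {K : Subfield F} [Infinite K] {lam : F} {k i : ℕ} (hi1 : 1 ≤ i)
    (hi : i ≤ k) (hk : 2 * k ≤ (minpoly K lam).natDegree) :
    wt K (powSpan K lam k) (k - i) = 0 := by
  have hne : ∀ c : K, lam ^ i + (c : F) ≠ 0 := by
    intro c h0
    have h := eq_zero_of_aeval_eq_zero (K := K) (lam := lam) (p := X ^ i + C c) (by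
      rw [degree_X_pow_add_C (by omega)]
      exact_mod_cast (by omega : i < (minpoly K lam).natDegree)) (by
      rw [map_add, map_pow, aeval_X, aeval_C]
      exact h0)
    exact X_pow_add_C_ne_zero (by omega) c h
  refine Set.Infinite.ncard (Set.infinite_of_injective_forall_mem
    (f := fun c : K => smulSub K (lam ^ i + (c : F)) (powSpan K lam k)) ?_ ?_)
  · intro c c' h
    dsimp only at h
    rw [smulSub_powSpan_eq_iff (by omega) hk (hne c) (hne c')] at h
    set u : K := ⟨_, h⟩ with hu
    have hu' : (lam ^ i + (c : F)) = u * (lam ^ i + (c' : F)) :=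
      (div_mul_cancel₀ _ (hne c')).symm
    have h0 : (X ^ i + C c : K[X]) - C u * (X ^ i + C c') = 0 := by
      apply eq_zero_of_aeval_eq_zero (lam := lam)
      · have h1 : (X ^ i + C c : K[X]).natDegree = i := natDegree_X_pow_add_C
        have h2 : (C u * (X ^ i + C c') : K[X]).natDegree ≤ i :=
          (natDegree_C_mul_le _ _).trans natDegree_X_pow_add_C.le
        have h3 := natDegree_sub_le (X ^ i + C c : K[X]) (C u * (X ^ i + C c'))
        refine degree_le_natDegree.trans_lt ?_
        exact_mod_cast (by omega : ((X ^ i + C c : K[X]) - C u * (X ^ i + C c')).natDegree <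
          (minpoly K lam).natDegree)
      · simp only [map_sub, map_add, map_mul, map_pow, aeval_X, aeval_C]
        exact sub_eq_zero.2 hu'
    have hi0 : i ≠ 0 := by omega
    have e1 := congrArg (fun p => coeff p i) h0
    have e2 := congrArg (fun p => coeff p 0) h0
    simp [coeff_C, hi0] at e1
    simp [hi0.symm] at e2
    rw [sub_eq_zero] at e1 e2
    rw [e2, ← e1, one_mul]
  · intro c
    refine ⟨⟨_, hne c, rfl⟩, ?_⟩
    have := finrank_powSpan_inf_smulSub (lam := lam) (f := X ^ i + C c) (g := 1) hk le_rfl (hne c)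
      isCoprime_one_right (natDegree_X_pow_add_C.le.trans hi) (by simp) (by simp)
      (by simp; rfl)
    simpa using this

theorem card_filter_mem_ne_zero [Fintype F] [DecidableEq F] (K : Subfield F) (S : Submodule K F)
    [DecidablePred (· ∈ S)] :
    ((Finset.univ.filter fun x : F => x ∈ S ∧ x ≠ 0).card : ℤ) =
      (Nat.card K : ℤ) ^ finrank K S - 1 := by
  have h1 : (Finset.univ.filter fun x : F => x ∈ S ∧ x ≠ 0) =
      (Finset.univ.filter fun x : F => x ∈ S).erase 0 := by
    ext x; simp [and_comm]
  have h2 : (Finset.univ.filter fun x : F => x ∈ S).card = Nat.card K ^ finrank K S := by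
    rw [← Module.natCard_eq_pow_finrank (K := K) (V := S), ← Fintype.card_subtype,
      Nat.card_eq_fintype_card]
  rw [h1, Finset.card_erase_of_mem (by simp), h2, Nat.cast_sub, Nat.cast_pow, Nat.cast_one]
  exact Nat.one_le_pow _ _ Nat.card_pos

/-- Counting pairs of nonzero elements of `S` according to their quotient. -/
theorem sq_card_sub_one_eq_sum [Fintype F] [DecidableEq F] (K : Subfield F)
    (S : Submodule K F) :
    ((Nat.card K : ℤ) ^ finrank K S - 1) ^ 2 =
      ∑ α : F with α ≠ 0, ((Nat.card K : ℤ) ^ finrank K ↥(S ⊓ smulSub K α S) - 1) := by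
  classical
  set A := Finset.univ.filter fun x : F => x ∈ S ∧ x ≠ 0 with hA
  have hfib := Finset.card_eq_sum_card_fiberwise (s := A ×ˢ A)
    (f := fun p : F × F => p.1 / p.2) (t := Finset.univ.filter fun α : F => α ≠ 0) (by
      rintro ⟨x, y⟩ h
      simp [hA] at h ⊢
      tauto)
  rw [Finset.card_product] at hfib
  rw [← card_filter_mem_ne_zero K S, sq, ← Nat.cast_mul, hfib, Nat.cast_sum]
  refine Finset.sum_congr rfl fun α hα => ?_
  have hα0 : α ≠ 0 := by simpa using hα
  rw [← card_filter_mem_ne_zero K (S ⊓ smulSub K α S), Nat.cast_inj]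
  refine Finset.card_bij' (fun p _ => p.1) (fun x _ => (x, x / α)) ?_ ?_ ?_ ?_
  · rintro ⟨x, y⟩ h
    simp only [hA, Finset.mem_filter, Finset.mem_product, Finset.mem_univ, true_and,
      Submodule.mem_inf, mem_smulSub] at h ⊢
    obtain ⟨⟨⟨hx, hx0⟩, hy, hy0⟩, rfl⟩ := h
    exact ⟨⟨hx, y, hy, div_mul_cancel₀ _ hy0⟩, hx0⟩
  · intro x h
    simp only [hA, Finset.mem_filter, Finset.mem_product, Finset.mem_univ, true_and,
      Submodule.mem_inf, mem_smulSub] at h ⊢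
    obtain ⟨⟨hx, y, hy, rfl⟩, hx0⟩ := h
    have hy0 := right_ne_zero_of_mul hx0
    rw [mul_div_cancel_left₀ _ hα0]
    exact ⟨⟨⟨hx, hx0⟩, hy, hy0⟩, mul_div_cancel_right₀ _ hy0⟩
  · rintro ⟨x, y⟩ h
    simp only [hA, Finset.mem_filter, Finset.mem_product, Finset.mem_univ, true_and] at h
    obtain ⟨⟨⟨hx, hx0⟩, hy, hy0⟩, rfl⟩ := h
    rw [div_div_cancel₀ hx0]
  · intro x h
    rfl

theorem wt_powSpan_mul [Fintype F] [DecidableEq F] {K : Subfield F} {lam : F} {k : ℕ}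
    (hk1 : 1 ≤ k) (hk : 2 * k ≤ (minpoly K lam).natDegree) (d : ℕ) :
    ((Finset.univ.filter fun α : F => α ≠ 0 ∧
      finrank K ↥(powSpan K lam k ⊓ smulSub K α (powSpan K lam k)) = d).card : ℤ) =
      wt K (powSpan K lam k) d * ((Nat.card K : ℤ) - 1) := by
  classical
  set S := powSpan K lam k
  set A := Finset.univ.filter fun α : F => α ≠ 0 ∧ finrank K ↥(S ⊓ smulSub K α S) = d with hA
  have hwt : wt K S d = (A.image fun α => smulSub K α S).card := by
    rw [wt, ← Set.ncard_coe_finset]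
    congr 1
    ext T
    simp only [Orb, Set.mem_ofPred_eq, Finset.coe_image, Set.mem_image, hA, Finset.mem_coe,
      Finset.mem_filter, Finset.mem_univ, true_and]
    constructor
    · rintro ⟨⟨α, hα, rfl⟩, h⟩
      exact ⟨α, ⟨hα, h⟩, rfl⟩
    · rintro ⟨α, ⟨hα, h⟩, rfl⟩
      exact ⟨⟨α, hα, rfl⟩, h⟩
  have hK := card_filter_mem_ne_zero K (Submodule.span K {(1 : F)})
  rw [finrank_span_singleton one_ne_zero, pow_one] at hK
  rw [← hK, hwt, ← Nat.cast_mul, Nat.cast_inj, ← smul_eq_mul, ← Finset.sum_const,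
    Finset.card_eq_sum_card_image (fun α => smulSub K α S) A]
  refine Finset.sum_congr rfl fun T hT => ?_
  obtain ⟨β, hβ, rfl⟩ := Finset.mem_image.1 hT
  simp only [hA, Finset.mem_filter, Finset.mem_univ, true_and] at hβ
  refine Finset.card_bij' (fun α _ => α / β) (fun c _ => c * β) ?_ ?_ ?_ ?_
  · intro α h
    simp only [hA, Finset.mem_filter, Finset.mem_univ, true_and] at h ⊢
    rw [smulSub_powSpan_eq_iff hk1 hk h.1.1 hβ.1] at h
    refine ⟨Submodule.mem_span_singleton.2 ⟨⟨_, h.2⟩, ?_⟩, div_ne_zero h.1.1 hβ.1⟩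
    simp [Subfield.smul_def]
  · intro c h
    simp only [hA, Finset.mem_filter, Finset.mem_univ, true_and,
      Submodule.mem_span_singleton] at h ⊢
    obtain ⟨⟨a, ha⟩, h0⟩ := h
    have hc : c ∈ K := by
      rw [← ha, Subfield.smul_def, smul_eq_mul, mul_one]
      exact a.2
    have hT : smulSub K (c * β) S = smulSub K β S := by
      rw [← smulSub_smulSub, smulSub_of_mem hc h0]
    rw [hT]
    exact ⟨⟨mul_ne_zero h0 hβ.1, hβ.2⟩, rfl⟩
  · intro α _
    exact div_mul_cancel₀ _ hβ.1
  · intro c _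
    exact mul_div_cancel_right₀ _ hβ.1

/-- Partial sums of `N` from two consecutive weighted convolution identities. -/
theorem sum_eq_of_sq_eq_sum {q : ℤ} (hq : q ≠ 1) {N : ℕ → ℤ} {m : ℕ}
    (h : (q ^ m - 1) ^ 2 = ∑ j ∈ Finset.range m, N j * (q ^ (m - j) - 1))
    (h' : (q ^ (m + 1) - 1) ^ 2 =
      ∑ j ∈ Finset.range (m + 1), N j * (q ^ (m + 1 - j) - 1)) :
    ∑ j ∈ Finset.range (m + 1), N j = q ^ (2 * m + 1) - 1 := by
  have h1 : ∑ j ∈ Finset.range (m + 1), N j * (q ^ (m + 1 - j) - 1) =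
      q * ∑ j ∈ Finset.range m, N j * (q ^ (m - j) - 1) +
        (q - 1) * ∑ j ∈ Finset.range (m + 1), N j := by
    have h2 : ∑ j ∈ Finset.range m, N j * (q ^ (m - j) - 1) =
        ∑ j ∈ Finset.range (m + 1), N j * (q ^ (m - j) - 1) := by
      simp [Finset.sum_range_succ]
    rw [h2, Finset.mul_sum, Finset.mul_sum, ← Finset.sum_add_distrib]
    refine Finset.sum_congr rfl fun j hj => ?_
    rw [Nat.succ_sub (by simpa [Nat.lt_succ_iff] using hj), pow_succ]
    ring
  rw [← h, ← h'] at h1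
  apply mul_left_cancel₀ (sub_ne_zero.2 hq)
  linear_combination -h1

/-- The number of nonzero `α` for which `S ∩ αS` has dimension at least `k - m`. -/
theorem sum_card_height [Fintype F] [DecidableEq F] {K : Subfield F} {lam : F} {k : ℕ}
    (hk : 2 * k ≤ (minpoly K lam).natDegree) {m : ℕ} (hm : m < k) :
    ∑ j ∈ Finset.range (m + 1), ((Finset.univ.filter fun α : F => α ≠ 0 ∧
      finrank K ↥(powSpan K lam k ⊓ smulSub K α (powSpan K lam k)) = k - j).card : ℤ) =
      (Nat.card K : ℤ) ^ (2 * m + 1) - 1 := by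
  have hheight : ∀ α : F, ∃ e ≤ k, α ≠ 0 → ∀ m ≤ k,
      finrank K ↥(powSpan K lam m ⊓ smulSub K α (powSpan K lam m)) = m - e := by
    intro α
    by_cases hα : α = 0
    · exact ⟨0, by omega, fun h => absurd hα h⟩
    · obtain ⟨e, he, h⟩ := exists_height hk hα
      exact ⟨e, he, fun _ => h⟩
  choose e he hD using hheight
  have key : ∀ m ≤ k, ((Nat.card K : ℤ) ^ m - 1) ^ 2 =
      ∑ j ∈ Finset.range m, ((Finset.univ.filter fun α : F => α ≠ 0 ∧
        finrank K ↥(powSpan K lam k ⊓ smulSub K α (powSpan K lam k)) = k - j).card : ℤ) *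
          ((Nat.card K : ℤ) ^ (m - j) - 1) := by
    intro m hm
    have h := sq_card_sub_one_eq_sum K (powSpan K lam m)
    rw [finrank_powSpan (by omega)] at h
    have hmaps : ∀ α ∈ Finset.univ.filter (fun α : F => α ≠ 0), e α ∈ Finset.range (k + 1) :=
      fun α _ => Finset.mem_range.2 (Nat.lt_succ_of_le (he α))
    rw [h, ← Finset.sum_fiberwise_of_maps_to hmaps]
    have hsub : Finset.range m ⊆ Finset.range (k + 1) :=
      Finset.range_subset_range.2 (by omega)
    rw [← Finset.sum_subset hsub (f := fun j => ∑ α ∈ (Finset.univ.filter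
      (fun α : F => α ≠ 0)).filter (fun α => e α = j), ((Nat.card K : ℤ) ^
        finrank K ↥(powSpan K lam m ⊓ smulSub K α (powSpan K lam m)) - 1))]
    · refine Finset.sum_congr rfl fun j hj => ?_
      rw [Finset.mem_range] at hj
      rw [← nsmul_eq_mul, ← Finset.sum_const, Finset.filter_filter]
      refine Finset.sum_congr ?_ fun α hα => ?_
      · ext α
        simp only [Finset.mem_filter, Finset.mem_univ, true_and]
        refine and_congr_right fun hα => ?_
        rw [hD α hα k le_rfl]
        have := he α
        omega
      · simp only [Finset.mem_filter, Finset.mem_univ, true_and] at hα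
        have h1 := hD α hα.1 k le_rfl
        have h2 := he α
        have : e α = j := by omega
        rw [hD α hα.1 m hm, this]
    · intro j _ hj
      rw [Finset.mem_range, not_lt] at hj
      refine Finset.sum_eq_zero fun α hα => ?_
      simp only [Finset.mem_filter, Finset.mem_univ, true_and] at hα
      rw [hD α hα.1 m hm, hα.2, Nat.sub_eq_zero_of_le hj]
      simp
  have hq : (Nat.card K : ℤ) ≠ 1 := by exact_mod_cast (Finite.one_lt_card (α := K)).ne'
  exact sum_eq_of_sq_eq_sum hq (key m hm.le) (key (m + 1) hm)

theorem sum_card_finrank [Fintype F] [DecidableEq F] (K : Subfield F) (lam : F) {k : ℕ}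
    (hk : 2 * k ≤ (minpoly K lam).natDegree) :
    ∑ j ∈ Finset.range (k + 1), ((Finset.univ.filter fun α : F => α ≠ 0 ∧
      finrank K ↥(powSpan K lam k ⊓ smulSub K α (powSpan K lam k)) = k - j).card : ℤ) =
      (Nat.card F : ℤ) - 1 := by
  have hc : (Finset.univ.filter fun α : F => α ≠ 0).card = Nat.card F - 1 := by
    rw [Finset.filter_ne', Finset.card_erase_of_mem (Finset.mem_univ _), Finset.card_univ,
      Nat.card_eq_fintype_card]
  have hmaps : Set.MapsTo
      (fun α : F => k - finrank K ↥(powSpan K lam k ⊓ smulSub K α (powSpan K lam k)))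
      (Finset.univ.filter fun α : F => α ≠ 0 : Finset F) (Finset.range (k + 1)) := by
    intro α _
    simp
  rw [Finset.card_eq_sum_card_fiberwise hmaps] at hc
  rw [← Nat.cast_pred Nat.card_pos, ← hc, Nat.cast_sum]
  refine Finset.sum_congr rfl fun j hj => ?_
  rw [Finset.filter_filter]
  congr 2
  ext α
  simp only [Finset.mem_filter, Finset.mem_univ, true_and]
  refine and_congr_right fun hα => ?_
  obtain ⟨e, he, hD⟩ := exists_height hk hα
  rw [hD k le_rfl]
  rw [Finset.mem_range] at hj
  omega

end PowSpan

/-- for `S = ⟨1, λ, …, λ^{k-1}⟩_{Fq}` with `1 ≤ k < t` and `2k ≤ t`: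
`ω_{2i}(Orb S) = (q+1)q^{2i-1}` for `i ∈ {1, …, k-1}` and
`ω_{2k}(Orb S) = (q^n - q^{2k-1})/(q-1)`. -/
theorem stmt18 (q n : ℕ) (hn : 0 < n)
    (F : Type*) [Field F] (hF : Nat.card F = q ^ n)
    (Fq : Subfield F) (hq : Nat.card Fq = q)
    (lam : F) (hlam : lam ∉ Fq)
    (t : ℕ) (ht : t = (minpoly Fq lam).natDegree)
    (k : ℕ) (hk1 : 1 ≤ k) (hk2 : k < t) (hk3 : 2 * k ≤ t)
    (S : Submodule Fq F)
    (hS : S = Submodule.span Fq {x : F | ∃ j < k, x = lam ^ j}) :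
    (∀ i : ℕ, 1 ≤ i → i ≤ k - 1 →
        wt Fq S (k - i) = (q + 1) * q ^ (2 * i - 1)) ∧
      (wt Fq S 0 : ℚ) = ((q : ℚ) ^ n - (q : ℚ) ^ (2 * k - 1)) / ((q : ℚ) - 1) := by
  subst hS ht hq
  rw [← powSpan_eq_span]
  rcases finite_or_infinite Fq with hfin | hinf
  · have hFfin : Finite F := by
      apply Nat.finite_of_card_ne_zero
      rw [hF]
      exact pow_ne_zero _ Nat.card_pos.ne'
    have := Fintype.ofFinite F
    classical
    have hq1 : ((Nat.card Fq : ℕ) : ℤ) - 1 ≠ 0 := by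
      rw [sub_ne_zero]
      exact_mod_cast (Finite.one_lt_card (α := Fq)).ne'
    constructor
    · intro i hi1 hi
      have h1 := sum_card_height hk3 (m := i) (by omega)
      have h2 := sum_card_height hk3 (m := i - 1) (by omega)
      rw [Finset.sum_range_succ] at h1
      rw [Nat.sub_add_cancel hi1] at h2
      rw [h2, wt_powSpan_mul hk1 hk3] at h1
      obtain ⟨j, rfl⟩ : ∃ j, i = j + 1 := ⟨i - 1, by omega⟩
      zify
      apply mul_right_cancel₀ hq1
      rw [Nat.add_sub_cancel] at h1
      rw [show 2 * (j + 1) - 1 = 2 * j + 1 by omega]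
      linear_combination h1
    · have h1 := sum_card_finrank Fq lam hk3
      have h2 := sum_card_height hk3 (m := k - 1) (by omega)
      rw [Finset.sum_range_succ] at h1
      rw [Nat.sub_add_cancel hk1] at h2
      rw [h2, wt_powSpan_mul hk1 hk3, Nat.sub_self, hF,
        show 2 * (k - 1) + 1 = 2 * k - 1 by omega] at h1
      have hq1' : ((Nat.card Fq : ℕ) : ℚ) - 1 ≠ 0 := by exact_mod_cast hq1
      rw [eq_div_iff hq1']
      have h3 : (wt Fq (powSpan Fq lam k) 0 : ℤ) * ((Nat.card Fq : ℤ) - 1) =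
          (Nat.card Fq : ℤ) ^ n - (Nat.card Fq : ℤ) ^ (2 * k - 1) := by
        push_cast at h1
        linear_combination h1
      exact_mod_cast h3
  · have h0 : Nat.card Fq = 0 := Nat.card_eq_zero_of_infinite
    constructor
    · intro i hi1 hi
      rw [wt_powSpan_of_infinite hi1 (by omega) hk3, h0, zero_pow (by omega), mul_zero]
    · have h := wt_powSpan_of_infinite (K := Fq) hk1 le_rfl hk3
      rw [Nat.sub_self] at h
      rw [h, h0, Nat.cast_zero, zero_pow hn.ne', zero_pow (by omega)]
      simp
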